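/- For all integers 1 ≤ j < g and every odd s with 2j+1 ≤ s ≤ 2g−1, one has σ ∘ D_s^{(g)} = 0 as a map B_g → B_j; that is, the polynomial vector field D_s defined for genus g vanishes identically on the coordinate subspace ℂ^{3j} ⊂ ℂ^{3g}. -/

import Mathlib

open MvPolynomial

noncomputable section

/-- B_g = ℂ[b_{i,j} : i ∈ {1,2,3}, j odd, 1 ≤ j ≤ 2g−1], as a polynomial ring in 3g variables;
the variable (i, m) : Fin 3 × Fin g stands for b_{i+1, 2m+1}. -/
abbrev Bg (g : ℕ) : Type := MvPolynomial (Fin 3 × Fin g) ℂ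

/-- `bb g i m` is the variable b_{i, 2m−1} (zero if i ∉ {1,2,3} or m ∉ {1,…,g}). -/
noncomputable def bb (g : ℕ) (i m : ℕ) : Bg g :=
  if h : 1 ≤ i ∧ i ≤ 3 ∧ 1 ≤ m ∧ m ≤ g then
    MvPolynomial.X (⟨i - 1, by omega⟩, ⟨m - 1, by omega⟩) else 0

/-- `bv g i j` is the variable b_{i,j} for odd j (zero for j > 2g−1). -/
noncomputable def bv (g : ℕ) (i j : ℕ) : Bg g :=
  if Odd j then bb g i ((j + 1) / 2) else 0

/-- `Qg g a c` is p_{2a−1, 2c−1} for 1 ≤ a ≤ c, by the elimination recursion. -/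
noncomputable def Qg (g : ℕ) : ℕ → ℕ → Bg g
  | 0, _ => 0
  | 1, c => 2 * bb g 1 c
  | 2, c => 6 * bb g 1 1 * bb g 1 c - bb g 3 c + 6 * bb g 1 (c + 1)
  | 3, c => bb g 3 1 * bb g 1 c - bb g 2 1 * bb g 2 c + bb g 1 1 * bb g 3 c
      - 2 * (4 * bb g 1 1 ^ 2 + bb g 1 2) * bb g 1 c
      + 10 * bb g 1 1 * bb g 1 (c + 1) - 2 * bb g 3 (c + 1) + 10 * bb g 1 (c + 2)
  | (a + 4), c => 2 * (if c + 1 ≤ g then Qg g (a + 3) (c + 1) else 0)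
      - (if c + 2 ≤ g then Qg g (a + 2) (c + 2) else 0)
      - 8 * bb g 1 1 * bb g 1 (a + 2) * bb g 1 c - 2 * bb g 1 c * bb g 1 (a + 3)
      - 2 * bb g 1 (a + 2) * bb g 1 (c + 1) + bb g 1 (a + 2) * bb g 3 c
      - bb g 2 (a + 2) * bb g 2 c + bb g 3 (a + 2) * bb g 1 c

/-- `pp g k l` is p_{k,l} for odd k, l (zero if k > 2g−1 or l > 2g−1). -/
noncomputable def pp (g : ℕ) (k l : ℕ) : Bg g :=
  if Odd k ∧ Odd l ∧ k ≤ 2 * g - 1 ∧ l ≤ 2 * g - 1 then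
    if k ≤ l then Qg g ((k + 1) / 2) ((l + 1) / 2) else Qg g ((l + 1) / 2) ((k + 1) / 2)
  else 0

/-- 𝐛ᵢ(ξ) = Σ_{m=1}^{g} b_{i,2m−1} ξᵐ ∈ B_g[ξ]. -/
noncomputable def Bcoef (g i : ℕ) : Polynomial (Bg g) :=
  ∑ m ∈ Finset.Icc 1 g, Polynomial.C (bb g i m) * Polynomial.X ^ m

/-- The polynomial ξ𝐛₂(ξ)² + 2ξ𝐛₃(ξ)(1 − 𝐛₁(ξ)) + 4(1 + 2b_{1,1}ξ)(1 − 𝐛₁(ξ))². -/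
noncomputable def Fg (g : ℕ) : Polynomial (Bg g) :=
  Polynomial.X * (Bcoef g 2) ^ 2 + 2 * Polynomial.X * Bcoef g 3 * (1 - Bcoef g 1)
    + 4 * (1 + 2 * Polynomial.C (bb g 1 1) * Polynomial.X) * (1 - Bcoef g 1) ^ 2

/-- `lam g m` is λ_{2m+2}, defined by 4λ_{2m+2} = coefficient of ξ^{m+1} in `Fg g`. -/
noncomputable def lam (g m : ℕ) : Bg g := ((1 : ℂ) / 4) • ((Fg g).coeff (m + 1))

/-- The polynomial vector field D₁ on B_g:
D₁(b_{1,j}) = b_{2,j}, D₁(b_{2,j}) = b_{3,j},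
D₁(b_{3,j}) = 4(2b_{1,1}b_{2,j} + b_{2,1}b_{1,j} + b_{2,j+2}) (with b_{2,2g+1} = 0). -/
noncomputable def D1g (g : ℕ) : Derivation ℂ (Bg g) (Bg g) :=
  MvPolynomial.mkDerivation ℂ (fun v : Fin 3 × Fin g =>
    if (v.1 : ℕ) = 0 then bb g 2 ((v.2 : ℕ) + 1)
    else if (v.1 : ℕ) = 1 then bb g 3 ((v.2 : ℕ) + 1)
    else 4 * (2 * bb g 1 1 * bb g 2 ((v.2 : ℕ) + 1) + bb g 2 1 * bb g 1 ((v.2 : ℕ) + 1)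
      + bb g 2 ((v.2 : ℕ) + 2)))

/-- The polynomial vector field D_s on B_g (for odd s ≥ 3):
D_s(b_{i,j}) = (1/2)·D₁ⁱ(p_{s,j}); for s = 1 it is D₁.  (For s = 2g+1 the
conventions p_{s,j} = 0 make it the zero vector field.) -/
noncomputable def Dsg (g s : ℕ) : Derivation ℂ (Bg g) (Bg g) :=
  if s = 1 then D1g g else
  MvPolynomial.mkDerivation ℂ (fun v : Fin 3 × Fin g =>
    ((1 : ℂ) / 2) • (((D1g g).toLinearMap ^ ((v.1 : ℕ) + 1)) (pp g s (2 * (v.2 : ℕ) + 1))))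

/-- The multiplication operator by c ∈ B_g. -/
noncomputable def mulBg (g : ℕ) (c : Bg g) : Module.End ℂ (Bg g) := LinearMap.mulLeft ℂ c

/-- D_s as a ℂ-linear endomorphism of B_g. -/
noncomputable def DLg (g s : ℕ) : Module.End ℂ (Bg g) := (Dsg g s).toLinearMap

/-- ℒ = D₁² − 2b_{1,1}. -/
noncomputable def Lg (g : ℕ) : Module.End ℂ (Bg g) := DLg g 1 ^ 2 - mulBg g (2 * bb g 1 1)

/-- The Buchstaber–Shorina polynomial differential operator
ℬ_{2k+1} = D_{2k−1}D₁² − (b_{1,1}D_{2k−1} + D_{2k−1}b_{1,1})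
  − (1/2)(b_{1,2k−1}D₁ + D₁b_{1,2k−1}) − D_{2k+1}. -/
noncomputable def Bopg (g k : ℕ) : Module.End ℂ (Bg g) :=
  DLg g (2 * k - 1) * DLg g 1 ^ 2
    - (mulBg g (bb g 1 1) * DLg g (2 * k - 1) + DLg g (2 * k - 1) * mulBg g (bb g 1 1))
    - ((1 : ℂ) / 2) • (mulBg g (bv g 1 (2 * k - 1)) * DLg g 1 + DLg g 1 * mulBg g (bv g 1 (2 * k - 1)))
    - DLg g (2 * k + 1)

/-- σ : B_g → B_j, the ℂ-algebra homomorphism with σ(b_{i,l}) = b_{i,l} for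
odd l ≤ 2j−1 and σ(b_{i,l}) = 0 for odd l with 2j−1 < l ≤ 2g−1. -/
noncomputable def sg (g j : ℕ) : Bg g →ₐ[ℂ] Bg j :=
  MvPolynomial.aeval (fun v : Fin 3 × Fin g =>
    if h : (v.2 : ℕ) < j then (MvPolynomial.X (v.1, ⟨(v.2 : ℕ), h⟩) : Bg j) else 0)

theorem sg_bb {g j : ℕ} (hjg : j ≤ g) (i m : ℕ) : sg g j (bb g i m) = bb j i m := by
  unfold bb sg
  by_cases h : 1 ≤ i ∧ i ≤ 3 ∧ 1 ≤ m ∧ m ≤ g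
  · rw [dif_pos h, aeval_X]
    by_cases hm : m ≤ j
    · rw [dif_pos (show m - 1 < j by omega), dif_pos (show 1 ≤ i ∧ i ≤ 3 ∧ 1 ≤ m ∧ m ≤ j by omega)]
    · rw [dif_neg (show ¬ m - 1 < j by omega), dif_neg (by omega)]
  · rw [dif_neg h, dif_neg (by omega), map_zero]

theorem bb_eq_zero_of_lt {g m : ℕ} (i : ℕ) (h : g < m) : bb g i m = 0 :=
  dif_neg (by omega)

theorem X_eq_bb {g : ℕ} (v : Fin 3 × Fin g) : (X v : Bg g) = bb g (v.1 + 1) (v.2 + 1) := by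
  rw [bb, dif_pos ⟨by omega, v.1.2, by omega, v.2.2⟩]
  rfl

/-- On the coordinate functions the vector field D₁ has its defining values; those with
index beyond the genus vanish. -/
theorem D1g_bb (g i m : ℕ) (hi : i < 3) (hm : 1 ≤ m) :
    D1g g (bb g (i + 1) m) =
      if i = 0 then bb g 2 m else if i = 1 then bb g 3 m
      else 4 * (2 * bb g 1 1 * bb g 2 m + bb g 2 1 * bb g 1 m + bb g 2 (m + 1)) := by
  by_cases h : m ≤ g
  · obtain ⟨n, rfl⟩ : ∃ n, m = n + 1 := ⟨m - 1, by omega⟩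
    rw [← X_eq_bb ((⟨i, hi⟩, ⟨n, h⟩) : Fin 3 × Fin g), D1g, mkDerivation_X]
  · have hm' : g < m := by omega
    simp [bb_eq_zero_of_lt _ hm', bb_eq_zero_of_lt _ (Nat.lt_succ_of_lt hm')]

theorem sg_D1g {g j : ℕ} (hjg : j ≤ g) (f : Bg g) :
    sg g j (D1g g f) = D1g j (sg g j f) := by
  induction f using MvPolynomial.induction_on with
  | C a => rw [← algebraMap_eq, Derivation.map_algebraMap, AlgHom.commutes,
      Derivation.map_algebraMap, map_zero]
  | add p q hp hq => simp only [map_add, hp, hq]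
  | mul_X p v hp =>
    have hv : sg g j (D1g g (X v)) = D1g j (sg g j (X v)) := by
      rw [X_eq_bb, sg_bb hjg, D1g_bb g _ _ v.1.2 (by omega), D1g_bb j _ _ v.1.2 (by omega)]
      split_ifs <;> simp [sg_bb hjg, map_ofNat]
    simp only [map_mul, Derivation.leibniz, smul_eq_mul, map_add, hp, hv]

theorem sg_D1g_pow {g j : ℕ} (hjg : j ≤ g) (n : ℕ) {f : Bg g} (hf : sg g j f = 0) :
    sg g j (((D1g g).toLinearMap ^ n) f) = 0 := by
  induction n with
  | zero => simpa using hf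
  | succ n ih =>
    rw [pow_succ', Module.End.mul_apply]
    change sg g j (D1g g (((D1g g).toLinearMap ^ n) f)) = 0
    rw [sg_D1g hjg, ih, map_zero]

theorem sg_Qg_eq_zero {g j : ℕ} (hjg : j ≤ g) (a c : ℕ) (hc : j < c) :
    sg g j (Qg g a c) = 0 := by
  have h0 (i : ℕ) : sg g j (bb g i c) = 0 := by rw [sg_bb hjg, bb_eq_zero_of_lt i hc]
  have h1 (i : ℕ) : sg g j (bb g i (c + 1)) = 0 := by
    rw [sg_bb hjg, bb_eq_zero_of_lt i (by omega)]
  have h2 (i : ℕ) : sg g j (bb g i (c + 2)) = 0 := by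
    rw [sg_bb hjg, bb_eq_zero_of_lt i (by omega)]
  match a with
  | 0 => simp [Qg]
  | 1 => simp [Qg, h0]
  | 2 => simp [Qg, h0, h1]
  | 3 => simp [Qg, h0, h1, h2]
  | a + 4 =>
    have q1 := sg_Qg_eq_zero hjg (a + 3) (c + 1) (by omega)
    have q2 := sg_Qg_eq_zero hjg (a + 2) (c + 2) (by omega)
    rw [Qg]
    split_ifs <;> simp [h0, h1, q1, q2]

theorem sg_pp_eq_zero {g j k : ℕ} (hjg : j ≤ g) (hk : 2 * j + 1 ≤ k) (l : ℕ) :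
    sg g j (pp g k l) = 0 := by
  unfold pp
  split_ifs
  · exact sg_Qg_eq_zero hjg _ _ (by omega)
  · exact sg_Qg_eq_zero hjg _ _ (by omega)
  · exact map_zero _

/-- for 1 ≤ j < g and odd s with 2j+1 ≤ s ≤ 2g−1, σ ∘ D_s^{(g)} = 0. -/
theorem stmt10 (g j : ℕ) (hj : 1 ≤ j) (hjg : j < g) :
    ∀ s, Odd s → 2 * j + 1 ≤ s → s ≤ 2 * g - 1 →
      ∀ f : Bg g, sg g j (Dsg g s f) = 0 := by
  intro s _ hs _ f
  induction f using MvPolynomial.induction_on with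
  | C a => rw [← algebraMap_eq, Derivation.map_algebraMap, map_zero]
  | add p q hp hq => rw [map_add, map_add, hp, hq, add_zero]
  | mul_X p v hp =>
    have hv : sg g j (Dsg g s (X v)) = 0 := by
      rw [Dsg, if_neg (by omega), mkDerivation_X, map_smul,
        sg_D1g_pow hjg.le _ (sg_pp_eq_zero hjg.le hs _), smul_zero]
    simp only [Derivation.leibniz, smul_eq_mul, map_add, map_mul, hp, hv, mul_zero, add_zero]

end
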